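/- arXiv:1310.8062 — 2 statements merged into one kernel-verified Lean document; each statement's English description precedes it below -/
import Mathlib

section
/- Let M be a concise n×m matrix represented by arrays a, b, c, let 1 ≤ j ≤ m, and suppose a(t) ≤ a(j) for every t with 1 ≤ t < j. Define μ(i) = min{ M(i,t) : 1 ≤ t ≤ j−1 } for each row i (with μ(i) = ∞ when j = 1). Then μ is non-decreasing on rows a(j), a(j)+1, …, n; in particular μ(a(j)) ≤ μ(a(j)+1) ≤ … ≤ μ(b(j)). -/
namespace RP

/-- Let `M` be a concise `n×m` matrix represented by arrays `a`, `b`,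
`c`, let `1 ≤ j ≤ m`, and suppose `a(t) ≤ a(j)` for every column `t < j`.  Let
`μ(i) = min { M(i,t) : 1 ≤ t ≤ j−1 }` (so `μ(i) = ∞` when `j = 1`).  Then `μ` is
non-decreasing on the rows `a(j), a(j)+1, …, n`; in particular
`μ(a(j)) ≤ μ(a(j)+1) ≤ … ≤ μ(b(j))`. -/
theorem running_minima_monotone (n m j : ℕ) (a b : ℕ → ℕ) (c : ℕ → ℝ)
    (M : ℕ → ℕ → WithTop ℝ) (μ : ℕ → WithTop ℝ)
    (hj : 1 ≤ j) (hjm : j ≤ m)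
    (hab : ∀ t, 1 ≤ t → t ≤ m → 1 ≤ a t ∧ a t ≤ b t ∧ b t ≤ n)
    (hM : ∀ i t, 1 ≤ t → t ≤ m →
      (a t ≤ i ∧ i ≤ b t → M i t = (c t : WithTop ℝ)) ∧
      (¬(a t ≤ i ∧ i ≤ b t) → M i t = ⊤))
    (ha : ∀ t, 1 ≤ t → t < j → a t ≤ a j)
    (hμ : ∀ i, μ i = (Finset.Ico 1 j).inf (fun t => M i t)) :
    ∀ i₁ i₂, a j ≤ i₁ → i₁ ≤ i₂ → i₂ ≤ n → μ i₁ ≤ μ i₂ := by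
  intro i₁ i₂ h1 h12 _
  rw [hμ i₁, hμ i₂]
  apply Finset.inf_mono_fun
  intro t ht
  rw [Finset.mem_Ico] at ht
  have hat := ha t ht.1 ht.2
  have htm : t ≤ m := by omega
  by_cases h : a t ≤ i₂ ∧ i₂ ≤ b t
  · rw [(hM i₂ t ht.1 htm).1 h, (hM i₁ t ht.1 htm).1 ⟨by omega, by omega⟩]
  · rw [(hM i₂ t ht.1 htm).2 h]
    exact le_top

end RP
end

section
/- Let M be a concise n×m matrix represented by arrays a, b, c, let h be a positive integer such that every column of M is h-brushed, and define M_1 and M_3 by M_1(i,j) = M(i,j) if a(j) ≤ i ≤ h·⌈a(j)/h⌉ and ∞ otherwise, and M_3(i,j) = M(i,j) if h·⌊b(j)/h⌋+1 ≤ i ≤ b(j) and ∞ otherwise. Then for every column j: (1) the set of rows with finite entries of column j of M_1 is nonempty, consists of at most h consecutive rows, and its largest row index h·⌈a(j)/h⌉ is an integral multiple of h; (2) the set of rows with finite entries of column j of M_3 consists of at most h−1 consecutive rows, and if it is nonempty then the row index immediately preceding its smallest row index, namely h·⌊b(j)/h⌋, is an integral multiple of h. Consequently thickness(M_1) ≤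 h, thickness(M_3) ≤ h−1, and both |{b_{M_1}(j) : 1 ≤ j ≤ m}| and |{a_{M_3}(j) : column j of M_3 is non-dummy}| are at most ⌊n/h⌋. -/
namespace RP

/-- Let `M` be a concise `n×m` matrix represented by arrays `a`, `b`,
`c`, let `h ≥ 1` be such that every column of `M` is `h`-brushed (i.e. `[a(j), b(j)]`
contains a multiple of `h`), and let `M₁` and `M₃` be the restrictions of `M` to the
row intervals `[a(j), h⌈a(j)/h⌉]` and `[h⌊b(j)/h⌋+1, b(j)]` of each column `j` (with
`∞` outside).  Then for every column `j`:
(1) the finite rows of column `j` of `M₁` form the nonempty interval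
`[a(j), h⌈a(j)/h⌉]` of at most `h` consecutive rows whose largest row index
`h⌈a(j)/h⌉` is a multiple of `h`; and
(2) the finite rows of column `j` of `M₃` form the interval `[h⌊b(j)/h⌋+1, b(j)]` of
at most `h−1` consecutive rows, the row index `h⌊b(j)/h⌋` immediately preceding it
being a multiple of `h`.
Consequently `thickness(M₁) ≤ h`, `thickness(M₃) ≤ h−1`, and the number of distinct
ending (resp. starting) row indices of the finite intervals of the columns of `M₁`
(resp. of the non-dummy columns of `M₃`) is at most `⌊n/h⌋`. -/
theorem brushed_parts_thickness_and_broadness (n m h : ℕ) (hh : 1 ≤ h)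
    (a b : ℕ → ℕ) (c : ℕ → ℝ) (M M₁ M₃ : ℕ → ℕ → WithTop ℝ)
    (hab : ∀ j, 1 ≤ j → j ≤ m → 1 ≤ a j ∧ a j ≤ b j ∧ b j ≤ n)
    (hM : ∀ i j, 1 ≤ j → j ≤ m →
      M i j = if a j ≤ i ∧ i ≤ b j then (c j : WithTop ℝ) else ⊤)
    (hbrush : ∀ j, 1 ≤ j → j ≤ m → ∃ t, a j ≤ h * t ∧ h * t ≤ b j)
    (hM₁ : ∀ i j, 1 ≤ j → j ≤ m →
      M₁ i j = if a j ≤ i ∧ i ≤ h * ((a j + h - 1) / h) then M i j else ⊤)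
    (hM₃ : ∀ i j, 1 ≤ j → j ≤ m →
      M₃ i j = if h * (b j / h) + 1 ≤ i ∧ i ≤ b j then M i j else ⊤) :
    (∀ j, 1 ≤ j → j ≤ m →
      {i | M₁ i j ≠ ⊤} = Set.Icc (a j) (h * ((a j + h - 1) / h)) ∧
      a j ≤ h * ((a j + h - 1) / h) ∧
      h * ((a j + h - 1) / h) - a j + 1 ≤ h ∧
      (∃ t, h * ((a j + h - 1) / h) = h * t)) ∧
    (∀ j, 1 ≤ j → j ≤ m →
      {i | M₃ i j ≠ ⊤} = Set.Icc (h * (b j / h) + 1) (b j) ∧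
      b j - h * (b j / h) ≤ h - 1 ∧
      (∃ t, h * (b j / h) = h * t)) ∧
    Set.ncard {v | ∃ j, 1 ≤ j ∧ j ≤ m ∧ v = h * ((a j + h - 1) / h)} ≤ n / h ∧
    Set.ncard {v | ∃ j, 1 ≤ j ∧ j ≤ m ∧ h * (b j / h) + 1 ≤ b j ∧
      v = h * (b j / h) + 1} ≤ n / h := by
  have key : ∀ j, 1 ≤ j → j ≤ m → ∃ q, (a j + h - 1) / h = q ∧ a j ≤ h * q ∧
      h * q + 1 ≤ a j + h ∧ h * q ≤ b j ∧ 1 ≤ q := by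
    intro j h1 h2
    obtain ⟨ha, hb, hn⟩ := hab j h1 h2
    obtain ⟨t, ht1, ht2⟩ := hbrush j h1 h2
    have e1 := Nat.div_add_mod (a j + h - 1) h
    have e2 := Nat.mod_lt (a j + h - 1) hh
    refine ⟨_, rfl, by omega, by omega, ?_, ?_⟩
    · refine le_trans (Nat.mul_le_mul_left h ?_) ht2
      rw [← Nat.lt_succ_iff, Nat.div_lt_iff_lt_mul hh]
      have : (t + 1) * h = h * t + h := by ring
      rw [Nat.succ_eq_add_one, this]
      omega
    · rw [Nat.le_div_iff_mul_le hh]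
      omega
  have key3 : ∀ j, 1 ≤ j → j ≤ m → ∃ q, b j / h = q ∧ a j ≤ h * q ∧
      h * q ≤ b j ∧ b j < h * q + h ∧ 1 ≤ q := by
    intro j h1 h2
    obtain ⟨ha, hb, hn⟩ := hab j h1 h2
    obtain ⟨p, -, hp1, hp2, hp3, hp4⟩ := key j h1 h2
    have e1 := Nat.div_add_mod (b j) h
    have e2 := Nat.mod_lt (b j) hh
    have hle : p ≤ b j / h := by
      rw [Nat.le_div_iff_mul_le hh, mul_comm]
      exact hp3
    exact ⟨_, rfl, hp1.trans (Nat.mul_le_mul_left h hle), by omega, by omega, by omega⟩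
  have count : ∀ (f : ℕ → ℕ) (S : Set ℕ),
      (∀ v ∈ S, ∃ q, 1 ≤ q ∧ h * q ≤ n ∧ f q = v) → S.ncard ≤ n / h := by
    intro f S hS
    have hsub : S ⊆ (((Finset.Icc 1 (n / h)).image f : Finset ℕ) : Set ℕ) := by
      intro v hv
      obtain ⟨q, h1, h2, h3⟩ := hS v hv
      rw [Finset.mem_coe, Finset.mem_image]
      refine ⟨q, Finset.mem_Icc.2 ⟨h1, ?_⟩, h3⟩
      rw [Nat.le_div_iff_mul_le hh, mul_comm]
      exact h2
    calc S.ncard ≤ _ := Set.ncard_le_ncard hsub (Finset.finite_toSet _)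
      _ = ((Finset.Icc 1 (n / h)).image f).card := Set.ncard_coe_finset _
      _ ≤ (Finset.Icc 1 (n / h)).card := Finset.card_image_le
      _ = n / h := by simp
  refine ⟨?_, ?_, ?_, ?_⟩
  · intro j h1 h2
    obtain ⟨q, hq, hq1, hq2, hq3, hq4⟩ := key j h1 h2
    have hMj := fun i => hM₁ i j h1 h2
    rw [hq] at hMj ⊢
    refine ⟨?_, hq1, by omega, q, rfl⟩
    ext i
    rw [Set.mem_setOf_eq, Set.mem_Icc, hMj, hM i j h1 h2]
    by_cases hi : a j ≤ i ∧ i ≤ h * q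
    · have hi' : a j ≤ i ∧ i ≤ b j := ⟨hi.1, hi.2.trans hq3⟩
      rw [if_pos hi, if_pos hi']
      exact iff_of_true (WithTop.coe_ne_top) hi
    · rw [if_neg hi]
      exact iff_of_false (fun h => h rfl) hi
  · intro j h1 h2
    obtain ⟨q, hq, hq1, hq2, hq3, hq4⟩ := key3 j h1 h2
    have hMj := fun i => hM₃ i j h1 h2
    rw [hq] at hMj ⊢
    refine ⟨?_, by omega, q, rfl⟩
    ext i
    rw [Set.mem_setOf_eq, Set.mem_Icc, hMj, hM i j h1 h2]
    by_cases hi : h * q + 1 ≤ i ∧ i ≤ b j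
    · have hi' : a j ≤ i ∧ i ≤ b j := ⟨by omega, hi.2⟩
      rw [if_pos hi, if_pos hi']
      exact iff_of_true (WithTop.coe_ne_top) hi
    · rw [if_neg hi]
      exact iff_of_false (fun h => h rfl) hi
  · apply count (fun q => h * q)
    rintro v ⟨j, h1, h2, rfl⟩
    obtain ⟨q, hq, hq1, hq2, hq3, hq4⟩ := key j h1 h2
    exact ⟨q, hq4, hq3.trans (hab j h1 h2).2.2, by rw [hq]⟩
  · apply count (fun q => h * q + 1)
    rintro v ⟨j, h1, h2, -, rfl⟩
    obtain ⟨q, hq, hq1, hq2, hq3, hq4⟩ := key3 j h1 h2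
    exact ⟨q, hq4, hq2.trans (hab j h1 h2).2.2, by rw [hq]⟩

end RP
end
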